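/- For every ε > 0 there exists N such that for all n ≥ N, the number of strictly metric path systems on the vertex set [n] is at least 2^{(0.51−ε)n²}. -/

import Mathlib

open SimpleGraph

/-- A path system on a simple graph `G`: for every pair of distinct vertices a chosen
simple path between them, with `P_{u,v} = P_{v,u}`. -/
structure PathSystem {V : Type*} (G : SimpleGraph V) where
  path : ∀ u v : V, u ≠ v → G.Path u v
  symm : ∀ (u v : V) (h : u ≠ v), (path v u (Ne.symm h)).val = (path u v h).val.reverse

namespace PathSystem

variable {V : Type*} {G : SimpleGraph V}

/-- A path system is consistent if whenever `a` lies on `P_{u,v}`, the path `P_{u,v}` is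
the concatenation of `P_{u,a}` and `P_{a,v}`. -/
def Consistent (P : PathSystem G) : Prop :=
  ∀ (u v : V) (huv : u ≠ v) (a : V) (hua : u ≠ a) (hav : a ≠ v),
    a ∈ (P.path u v huv).val.support →
      (P.path u v huv).val = (P.path u a hua).val.append (P.path a v hav).val

/-- A path system is neighborly if the chosen path between the endpoints of each edge is
that single edge. -/
def Neighborly (P : PathSystem G) : Prop :=
  ∀ (u v : V) (h : G.Adj u v),
    (P.path u v h.ne).val = SimpleGraph.Walk.cons h SimpleGraph.Walk.nil

/-- The `w`-weight of a walk: the sum of the weights of its edges. -/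
def wlen (w : Sym2 V → ℝ) {u v : V} (Q : G.Walk u v) : ℝ :=
  (Q.edges.map w).sum

/-- A path system is metric if for some positive edge weights every chosen path is a
shortest path between its endpoints. -/
def Metric (P : PathSystem G) : Prop :=
  ∃ w : Sym2 V → ℝ, (∀ e ∈ G.edgeSet, 0 < w e) ∧
    ∀ (u v : V) (h : u ≠ v) (Q : G.Path u v),
      wlen w (P.path u v h).val ≤ wlen w Q.val

/-- A path system is strictly metric if for some positive edge weights every chosen path
is the unique shortest path between its endpoints. -/
def StrictlyMetric (P : PathSystem G) : Prop :=
  ∃ w : Sym2 V → ℝ, (∀ e ∈ G.edgeSet, 0 < w e) ∧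
    ∀ (u v : V) (h : u ≠ v) (Q : G.Path u v), Q ≠ P.path u v h →
      wlen w (P.path u v h).val < wlen w Q.val

end PathSystem

/-- The length of the route from `u` to `v` prescribed by `mid`: the edge `uv` itself, or the
detour through the prescribed midpoint. -/
def midDist {V : Type*} (w : V → V → ℕ) (mid : V → V → Option V) (u v : V) : ℕ :=
  (mid u v).elim (w u v) fun m => w u m + w m v

/-- The vertices of the route from `u` to `v` prescribed by `mid`. -/
def midSupport {V : Type*} (mid : V → V → Option V) (u v : V) : List V :=
  (mid u v).elim [u, v] fun m => [u, m, v]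

/-- Local conditions under which the routes prescribed by `mid` are the unique `w`-shortest
paths. -/
structure IsMidpointSystem {V : Type*} (w : V → V → ℕ) (mid : V → V → Option V) : Prop where
  w_symm : ∀ u v, w u v = w v u
  w_pos : ∀ u v, u ≠ v → 0 < w u v
  mid_symm : ∀ u v, mid u v = mid v u
  mid_ne : ∀ u v m, u ≠ v → mid u v = some m → m ≠ u ∧ m ≠ v
  mid_mid : ∀ u v m, u ≠ v → mid u v = some m → mid m v = none
  midDist_lt : ∀ u v, u ≠ v → mid u v ≠ none → midDist w mid u v < w u v
  midDist_lt_add : ∀ u v x, u ≠ v → x ≠ u → x ≠ v → mid u v ≠ some x →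
    midDist w mid u v < w u x + midDist w mid x v

namespace IsMidpointSystem

variable {V V' : Type*} {w : V → V → ℕ} {mid : V → V → Option V}

theorem comap (h : IsMidpointSystem w mid) (e : V' ≃ V) :
    IsMidpointSystem (fun u v => w (e u) (e v)) (fun u v => (mid (e u) (e v)).map e.symm) := by
  have hd : ∀ u v, midDist (fun u v => w (e u) (e v))
      (fun u v => (mid (e u) (e v)).map e.symm) u v = midDist w mid (e u) (e v) := by
    intro u v
    unfold midDist
    cases h : mid (e u) (e v) <;> simp [h]
  refine ⟨fun u v => h.w_symm _ _, fun u v huv => h.w_pos _ _ (e.injective.ne huv),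
    fun u v => by rw [h.mid_symm], ?_, ?_, ?_, ?_⟩
  · intro u v m huv hm
    obtain ⟨m, hm', rfl⟩ := Option.map_eq_some_iff.1 hm
    have := h.mid_ne _ _ m (e.injective.ne huv) hm'
    simpa [Equiv.symm_apply_eq] using this
  · intro u v m huv hm
    obtain ⟨m, hm', rfl⟩ := Option.map_eq_some_iff.1 hm
    simpa using h.mid_mid _ _ m (e.injective.ne huv) hm'
  · intro u v huv hm
    rw [hd]
    exact h.midDist_lt _ _ (e.injective.ne huv) (by simpa using hm)
  · intro u v x huv hxu hxv hm
    rw [hd, hd]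
    refine h.midDist_lt_add _ _ _ (e.injective.ne huv) (e.injective.ne hxu)
      (e.injective.ne hxv) fun hx => hm ?_
    simp [hx]

theorem midDist_le (h : IsMidpointSystem w mid) {u v : V} (huv : u ≠ v) :
    midDist w mid u v ≤ w u v := by
  by_cases hm : mid u v = none
  · simp [midDist, hm]
  · exact (h.midDist_lt u v huv hm).le

/-- The symmetric weight function on edges, with real values. -/
def weight (h : IsMidpointSystem w mid) : Sym2 V → ℝ :=
  Sym2.lift ⟨fun u v => (w u v : ℝ), fun u v => congrArg Nat.cast (h.w_symm u v)⟩

theorem midDist_lt_wlen (h : IsMidpointSystem w mid) {u v : V}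
    (Q : (completeGraph V).Walk u v) (hQ : Q.IsPath) (huv : u ≠ v) :
    (midDist w mid u v : ℝ) ≤ PathSystem.wlen h.weight Q ∧
      (Q.support ≠ midSupport mid u v →
        (midDist w mid u v : ℝ) < PathSystem.wlen h.weight Q) := by
  induction Q with
  | nil => exact absurd rfl huv
  | @cons u x v hux Q ih =>
    have hux' : u ≠ x := hux.ne
    have hlen : PathSystem.wlen h.weight (Walk.cons hux Q) =
        w u x + PathSystem.wlen h.weight Q := by
      simp [PathSystem.wlen, weight]
    rw [Walk.cons_isPath_iff] at hQ
    rw [hlen, Walk.support_cons]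
    by_cases hxv : x = v
    · subst hxv
      obtain rfl : Q = Walk.nil := (Walk.isPath_iff_nil.1 hQ.1).eq_nil
      have h0 : PathSystem.wlen h.weight (Walk.nil : (completeGraph V).Walk x x) = 0 := by
        simp [PathSystem.wlen]
      rw [h0, add_zero]
      refine ⟨by exact_mod_cast h.midDist_le huv, fun hs => ?_⟩
      have hm : mid u x ≠ none := by
        intro hm
        simp [midSupport, hm] at hs
      exact_mod_cast h.midDist_lt u x huv hm
    · obtain ⟨ih₁, ih₂⟩ := ih hQ.1 hxv
      by_cases hm : mid u v = some x
      · have hxm := h.mid_mid u v x huv hm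
        have hd : (midDist w mid u v : ℝ) = w u x + midDist w mid x v := by
          simp [midDist, hm, hxm]
        rw [hd]
        refine ⟨by linarith, fun hs => ?_⟩
        have := ih₂ fun hs' => hs (by rw [hs']; simp [midSupport, hm, hxm])
        linarith
      · have hlt : (midDist w mid u v : ℝ) < w u x + midDist w mid x v := by
          exact_mod_cast h.midDist_lt_add u v x huv hux'.symm hxv hm
        exact ⟨by linarith, fun _ => by linarith⟩

theorem exists_path (h : IsMidpointSystem w mid) (u v : V) (huv : u ≠ v) :
    ∃ Q : (completeGraph V).Path u v, Q.val.support = midSupport mid u v ∧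
      PathSystem.wlen h.weight Q.val = midDist w mid u v := by
  rcases hm : mid u v with _ | m
  · refine ⟨⟨Walk.cons (v := v) (show (completeGraph V).Adj u v from huv) Walk.nil, ?_⟩, ?_, ?_⟩
    · simpa [Walk.cons_isPath_iff] using huv
    · simp [midSupport, hm]
    · simp [PathSystem.wlen, weight, midDist, hm]
  · obtain ⟨hmu, hmv⟩ := h.mid_ne u v m huv hm
    refine ⟨⟨Walk.cons (v := m) (show (completeGraph V).Adj u m from hmu.symm)
      (Walk.cons (v := v) (show (completeGraph V).Adj m v from hmv) Walk.nil), ?_⟩, ?_, ?_⟩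
    · simp [Walk.cons_isPath_iff, huv, hmu.symm, hmv]
    · simp [midSupport, hm]
    · simp [PathSystem.wlen, weight, midDist, hm]

theorem exists_strictlyMetric (h : IsMidpointSystem w mid) :
    ∃ P : PathSystem (completeGraph V), P.StrictlyMetric ∧
      ∀ u v (huv : u ≠ v), (P.path u v huv).val.support = midSupport mid u v := by
  choose path hs hl using h.exists_path
  refine ⟨⟨path, fun u v huv => Walk.ext_support ?_⟩, ⟨h.weight, ?_, ?_⟩, hs⟩
  · rw [Walk.support_reverse, hs, hs, midSupport, midSupport, h.mid_symm v u]
    cases mid u v <;> simp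
  · intro e he
    induction e with
    | _ u v =>
      have : u ≠ v := he
      simpa [weight] using h.w_pos u v this
  · intro u v huv Q hQ
    rw [hl]
    refine (h.midDist_lt_wlen Q.val Q.property huv).2 fun hsQ => hQ ?_
    exact Subtype.ext (Walk.ext_support (hsQ.trans (hs u v huv).symm))

end IsMidpointSystem

theorem midSupport_inj {V : Type*} {mid mid' : V → V → Option V} {u v : V}
    (h : midSupport mid u v = midSupport mid' u v) : mid u v = mid' u v := by
  unfold midSupport at h
  cases h₁ : mid u v <;> cases h₂ : mid' u v <;> simp_all

namespace HubConstruction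

/-- A hub, a set `A`, and a copy of `B × Bool` whose vertices are matched in pairs. -/
abbrev Vert (A B : Type*) := Option (A ⊕ B × Bool)

/-- How `a : A` is joined to the pair `(b, false), (b, true)`. `inl true`: by an edge to each;
`inl false`: through the hub to each; `inr (r, l)`: by an edge to `(b, r)`, and to `(b, !r)`
through `(b, r)` if `l` and through the hub otherwise. -/
abbrev JoinType := Bool ⊕ Bool × Bool

/-- The weight of the edge between `a : A` and `(b, s)`. -/
def joinWeight : JoinType → Bool → ℕ
  | .inl true, _ => 7
  | .inl false, _ => 20
  | .inr (r, l), s => if s = r then (if l then 5 else 7) else 20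

/-- The midpoint of the route between `a : A` and `(b, s)`. -/
def joinMid {A B : Type*} (b : B) : JoinType → Bool → Option (Vert A B)
  | .inl true, _ => none
  | .inl false, _ => some none
  | .inr (r, l), s => if s = r then none else if l then some (some (.inr (b, r))) else some none

theorem joinMid_injective {A B : Type*} (b : B) {x y : JoinType}
    (h : ∀ s, joinMid (A := A) b x s = joinMid b y s) : x = y := by
  have h₁ := h true
  have h₂ := h false
  rcases x with (_ | _) | ⟨_ | _, _ | _⟩ <;> rcases y with (_ | _) | ⟨_ | _, _ | _⟩ <;>
    simp [joinMid] at h₁ h₂ ⊢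

variable {A B : Type*} (G : SimpleGraph A) (t : A → B → JoinType)

open Classical in
/-- The weights of the construction with free choices `G` and `t`. -/
noncomputable def weight : Vert A B → Vert A B → ℕ
  | none, _ => 4
  | _, none => 4
  | some (.inl i), some (.inl j) => if G.Adj i j then 7 else 20
  | some (.inl i), some (.inr (b, s)) => joinWeight (t i b) s
  | some (.inr (b, s)), some (.inl i) => joinWeight (t i b) s
  | some (.inr (b, _)), some (.inr (c, _)) => if b = c then 2 else 20

open Classical in
/-- The midpoints of the construction with free choices `G` and `t`. -/
noncomputable def mid : Vert A B → Vert A B → Option (Vert A B)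
  | none, _ => none
  | _, none => none
  | some (.inl i), some (.inl j) => if G.Adj i j then none else some none
  | some (.inl i), some (.inr (b, s)) => joinMid b (t i b) s
  | some (.inr (b, s)), some (.inl i) => joinMid b (t i b) s
  | some (.inr (b, _)), some (.inr (c, _)) => if b = c then none else some none

/-- The distance between `a : A` and `(b, s)`. -/
def joinDist : JoinType → Bool → ℕ
  | .inl true, _ => 7
  | .inl false, _ => 8
  | .inr (r, l), s => if s = r then (if l then 5 else 7) else if l then 7 else 8

theorem five_le_joinWeight (x : JoinType) (s : Bool) : 5 ≤ joinWeight x s := by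
  rcases x with (_ | _) | ⟨_ | _, _ | _⟩ <;> cases s <;> simp [joinWeight]

theorem five_le_joinDist (x : JoinType) (s : Bool) : 5 ≤ joinDist x s := by
  rcases x with (_ | _) | ⟨_ | _, _ | _⟩ <;> cases s <;> simp [joinDist]

theorem joinDist_le (x : JoinType) (s : Bool) : joinDist x s ≤ 8 := by
  rcases x with (_ | _) | ⟨_ | _, _ | _⟩ <;> cases s <;> simp [joinDist]

theorem joinDist_lt_joinWeight {b : B} {x : JoinType} {s : Bool}
    (h : joinMid (A := A) b x s ≠ none) : joinDist x s < joinWeight x s := by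
  rcases x with (_ | _) | ⟨_ | _, _ | _⟩ <;> cases s <;>
    simp_all [joinDist, joinMid, joinWeight]

theorem joinDist_lt_eight {b : B} {x : JoinType} {s : Bool}
    (h : joinMid (A := A) b x s ≠ some none) : joinDist x s < 8 := by
  rcases x with (_ | _) | ⟨_ | _, _ | _⟩ <;> cases s <;> simp_all [joinDist, joinMid]

theorem joinDist_lt_joinWeight_add {b : B} {x : JoinType} {s r : Bool} (hsr : s ≠ r)
    (h : joinMid (A := A) b x s ≠ some (some (.inr (b, r)))) :
    joinDist x s < joinWeight x r + 2 := by
  rcases x with (_ | _) | ⟨_ | _, _ | _⟩ <;> cases s <;> cases r <;>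
    simp_all [joinDist, joinMid, joinWeight]

theorem joinDist_lt_add_joinDist {b : B} {x : JoinType} {s r : Bool} (hsr : s ≠ r)
    (h : joinMid (A := A) b x s ≠ some (some (.inr (b, r)))) :
    joinDist x s < 2 + joinDist x r := by
  rcases x with (_ | _) | ⟨_ | _, _ | _⟩ <;> cases s <;> cases r <;>
    simp_all [joinDist, joinMid]

theorem midDist_hub_left (v : Vert A B) : midDist (weight G t) (mid G t) none v = 4 := by
  simp [midDist, mid, weight]

theorem midDist_hub_right (v : Vert A B) : midDist (weight G t) (mid G t) v none = 4 := by
  rcases v with _ | i | ⟨b, s⟩ <;> simp [midDist, mid, weight]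

open Classical in
theorem midDist_inl_inl (i j : A) :
    midDist (weight G t) (mid G t) (some (.inl i)) (some (.inl j)) =
      if G.Adj i j then 7 else 8 := by
  split_ifs with h <;> simp [midDist, mid, weight, h]

theorem midDist_inl_inr (i : A) (b : B) (s : Bool) :
    midDist (weight G t) (mid G t) (some (.inl i)) (some (.inr (b, s))) =
      joinDist (t i b) s := by
  rcases h : t i b with (_ | _) | ⟨_ | _, _ | _⟩ <;> cases s <;>
    simp [midDist, mid, weight, h, joinMid, joinWeight, joinDist]

theorem midDist_inr_inl (i : A) (b : B) (s : Bool) :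
    midDist (weight G t) (mid G t) (some (.inr (b, s))) (some (.inl i)) =
      joinDist (t i b) s := by
  rcases h : t i b with (_ | _) | ⟨_ | _, _ | _⟩ <;> cases s <;>
    simp [midDist, mid, weight, h, joinMid, joinWeight, joinDist]

open Classical in
theorem midDist_inr_inr (b c : B) (s r : Bool) :
    midDist (weight G t) (mid G t) (some (.inr (b, s))) (some (.inr (c, r))) =
      if b = c then 2 else 8 := by
  split_ifs with h <;> simp [midDist, mid, weight, h]

theorem isMidpointSystem : IsMidpointSystem (weight G t) (mid G t) := by
  classical
  constructor
  · rintro (_ | i | ⟨b, s⟩) (_ | j | ⟨c, r⟩) <;> simp [weight, G.adj_comm, eq_comm]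
  · rintro (_ | i | ⟨b, s⟩) (_ | j | ⟨c, r⟩) <;> simp [weight, joinWeight] <;> intros <;>
      grind
  · rintro (_ | i | ⟨b, s⟩) (_ | j | ⟨c, r⟩) <;> simp [mid, G.adj_comm, eq_comm]
  · rintro (_ | i | ⟨b, s⟩) (_ | j | ⟨c, r⟩) m <;> simp [mid, joinMid] <;> grind
  · rintro (_ | i | ⟨b, s⟩) (_ | j | ⟨c, r⟩) m <;> simp [mid, joinMid] <;> grind [mid, joinMid]
  · rintro (_ | i | ⟨b, s⟩) (_ | j | ⟨c, r⟩) - hm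
    · exact absurd rfl hm
    · exact absurd rfl hm
    · exact absurd rfl hm
    · exact absurd rfl hm
    · rw [midDist_inl_inl]
      by_cases h : G.Adj i j <;> simp_all [mid, weight]
    · rw [midDist_inl_inr]
      exact joinDist_lt_joinWeight hm
    · exact absurd rfl hm
    · rw [midDist_inr_inl]
      exact joinDist_lt_joinWeight hm
    · rw [midDist_inr_inr]
      by_cases h : b = c <;> simp_all [mid, weight]
  · have key : ∀ i b c s r, (c, r) ≠ (b, s) →
        joinMid (A := A) b (t i b) s ≠ some (some (.inr (c, r))) →
        joinDist (t i b) s < joinWeight (t i c) r + (if c = b then 2 else 8) ∧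
          joinDist (t i b) s < (if b = c then 2 else 20) + joinDist (t i c) r := by
      intro i b c s r hne hm
      by_cases h : b = c
      · subst h
        have hsr : s ≠ r := fun h => hne (by rw [h])
        simpa using ⟨joinDist_lt_joinWeight_add hsr hm, joinDist_lt_add_joinDist hsr hm⟩
      · have := joinDist_le (t i b) s
        have := five_le_joinWeight (t i c) r
        simp only [h, Ne.symm h, if_false]
        omega
    rintro (_ | i | ⟨b, s⟩) (_ | j | ⟨c, r⟩) (_ | k | ⟨d, q⟩) huv hxu hxv hm <;>
      simp only [midDist_hub_left, midDist_hub_right, midDist_inl_inl, midDist_inl_inr,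
        midDist_inr_inl, midDist_inr_inr, weight] <;>
      simp only [mid] at hm <;>
      grind [joinDist_lt_eight, joinDist_le, five_le_joinDist, five_le_joinWeight]

theorem mid_injective {G G' : SimpleGraph A} {t t' : A → B → JoinType}
    (h : ∀ u v, u ≠ v → mid G t u v = mid G' t' u v) : G = G' ∧ t = t' := by
  constructor
  · ext i j
    rcases eq_or_ne i j with rfl | hij
    · simp
    · have := h (some (.inl i)) (some (.inl j)) (by simpa using hij)
      simp only [mid] at this
      split_ifs at this <;> simp_all
  · funext i b
    have h₁ := h (some (.inl i)) (some (.inr (b, true))) (by simp)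
    have h₂ := h (some (.inl i)) (some (.inr (b, false))) (by simp)
    exact joinMid_injective b (Bool.forall_bool.2 ⟨h₂, h₁⟩)

end HubConstruction

instance PathSystem.instFinite {V : Type*} [Finite V] (G : SimpleGraph V) :
    Finite (PathSystem G) := by
  classical
  cases nonempty_fintype V
  refine Finite.of_injective (fun P : PathSystem G => P.path) ?_
  rintro ⟨p, _⟩ ⟨q, _⟩ h
  cases h
  rfl

theorem two_pow_choose_le_card_simpleGraph (V : Type*) [Fintype V] :
    2 ^ (Fintype.card V).choose 2 ≤ Nat.card (SimpleGraph V) := by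
  classical
  have hinj : Function.Injective
      (fun S : Set {e : Sym2 V // ¬e.IsDiag} => fromEdgeSet (Subtype.val '' S)) := by
    intro S T h
    have hS : ∀ S : Set {e : Sym2 V // ¬e.IsDiag},
        (fromEdgeSet (Subtype.val '' S)).edgeSet = Subtype.val '' S := by
      intro S
      rw [edgeSet_fromEdgeSet, sdiff_eq_left, Set.disjoint_left]
      rintro _ ⟨e, -, rfl⟩
      exact e.property
    have h' := congrArg edgeSet h
    simp only [hS] at h'
    exact Subtype.val_injective.image_injective h'
  have := Nat.card_le_card_of_injective _ hinj
  rwa [Nat.card_eq_fintype_card, Fintype.card_set, Sym2.card_subtype_not_diag] at this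

theorem two_pow_mul_six_pow_le_card (p q : ℕ) :
    2 ^ p.choose 2 * 6 ^ (p * q) ≤
      Nat.card {P : PathSystem (completeGraph (Fin (1 + p + 2 * q))) // P.StrictlyMetric} := by
  have e : Fin (1 + p + 2 * q) ≃ HubConstruction.Vert (Fin p) (Fin q) :=
    Fintype.equivOfCardEq (by simp; ring)
  have hsys := fun c : SimpleGraph (Fin p) × (Fin p → Fin q → HubConstruction.JoinType) =>
    ((HubConstruction.isMidpointSystem c.1 c.2).comap e).exists_strictlyMetric
  choose P hP hs using hsys
  have hinj : Function.Injective (fun c => (⟨P c, hP c⟩ :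
      {P : PathSystem (completeGraph (Fin (1 + p + 2 * q))) // P.StrictlyMetric})) := by
    intro c c' h
    have hcc : P c = P c' := congrArg Subtype.val h
    have := HubConstruction.mid_injective (G := c.1) (G' := c'.1) (t := c.2) (t' := c'.2) ?_
    · exact Prod.ext this.1 this.2
    · intro u v huv
      have huv' : e.symm u ≠ e.symm v := e.symm.injective.ne huv
      have h₁ := hs c _ _ huv'
      rw [hcc, hs c' _ _ huv'] at h₁
      have h₂ := midSupport_inj h₁
      simp only [Equiv.apply_symm_apply] at h₂
      exact (Option.map_injective e.symm.injective h₂).symm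
  refine le_trans ?_ (Nat.card_le_card_of_injective _ hinj)
  rw [Nat.card_prod]
  refine Nat.mul_le_mul (by simpa using two_pow_choose_le_card_simpleGraph (Fin p)) (le_of_eq ?_)
  simp [Nat.card_eq_fintype_card, ← pow_mul, mul_comm]

theorem two_rpow_mul_le_six_pow (m : ℕ) : (2 : ℝ) ^ (2.5 * (m : ℝ)) ≤ 6 ^ m := by
  rw [Real.rpow_mul (by norm_num), Real.rpow_natCast]
  refine pow_le_pow_left₀ (by positivity) ?_ m
  refine le_of_pow_le_pow_left₀ two_ne_zero (by norm_num) ?_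
  rw [← Real.rpow_natCast, ← Real.rpow_mul (by norm_num)]
  norm_num

theorem count_strictly_metric_lower :
    ∀ ε : ℝ, 0 < ε → ∃ N : ℕ, ∀ n : ℕ, N ≤ n →
      (2 : ℝ) ^ ((0.51 - ε) * (n : ℝ) ^ 2) ≤
        (Nat.card {P : PathSystem (completeGraph (Fin n)) // P.StrictlyMetric} : ℝ) := by
  intro ε hε
  refine ⟨1000, fun n hn => ?_⟩
  obtain ⟨q, p, hpq, hq, hq'⟩ : ∃ q p : ℕ, n = 1 + p + 2 * q ∧ 10 * q ≤ n ∧ n ≤ 10 * q + 9 :=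
    ⟨n / 10, n - 1 - 2 * (n / 10), by omega, by omega, by omega⟩
  have hcard := two_pow_mul_six_pow_le_card p q
  rw [← hpq] at hcard
  have hcard' : (2 : ℝ) ^ p.choose 2 * 6 ^ (p * q) ≤
      (Nat.card {P : PathSystem (completeGraph (Fin n)) // P.StrictlyMetric} : ℝ) := by
    exact_mod_cast hcard
  refine le_trans ?_ hcard'
  refine le_trans ?_ (mul_le_mul_of_nonneg_left (two_rpow_mul_le_six_pow (p * q))
    (by positivity))
  rw [← Real.rpow_natCast 2 (p.choose 2), ← Real.rpow_add (by norm_num)]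
  refine Real.rpow_le_rpow_of_exponent_le (by norm_num) ?_
  rw [Nat.cast_choose_two]
  push_cast
  have hn' : (n : ℝ) = 1 + p + 2 * q := by exact_mod_cast hpq
  have h₁ : (10 : ℝ) * q ≤ n := by exact_mod_cast hq
  have h₂ : (n : ℝ) ≤ 10 * q + 9 := by exact_mod_cast hq'
  have h₃ : (1000 : ℝ) ≤ n := by exact_mod_cast hn
  have hp : (p : ℝ) = n - 1 - 2 * q := by linarith
  have hε' : 0 ≤ ε * (n : ℝ) ^ 2 := by positivity
  rw [hp]
  nlinarith [mul_nonneg (sub_nonneg.2 h₁) (sub_nonneg.2 h₂),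
    mul_nonneg (sub_nonneg.2 h₁) (sub_nonneg.2 h₃),
    mul_nonneg (sub_nonneg.2 h₂) (sub_nonneg.2 h₃)]
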